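/- arXiv:2209.03266 — 6 statements merged into one kernel-verified Lean document; each statement's English description precedes it below -/
import Mathlib

section
/- The infinite binary word 001001 t̄ (the word 001001 followed by the complement of the Thue–Morse word) is overlap-free, and every infinite overlap-free binary word is greater than or equal to 001001 t̄ in lexicographic order; that is, 001001 t̄ is the lexicographically least infinite overlap-free binary word. -/
/-- The Thue–Morse morphism μ : 0 ↦ 01, 1 ↦ 10 (false = 0, true = 1),
extended to finite binary words. -/
def mu (w : List Bool) : List Bool := (w.map (fun b => [b, !b])).flatten

/-- The set S = {ε, 0, 1, 00, 11}. -/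
def S : Set (List Bool) := {[], [false], [true], [false, false], [true, true]}

/-- A finite word `u` is a prefix of the infinite word `w`. -/
def PrefixSeq {α : Type*} (u : List α) (w : ℕ → α) : Prop :=
  ∀ (j : ℕ) (h : j < u.length), u.get ⟨j, h⟩ = w j

/-- A finite word `u` is a factor of the infinite word `w`. -/
def IsFactorSeq (u : List Bool) (w : ℕ → Bool) : Prop :=
  ∃ i : ℕ, ∀ (j : ℕ) (h : j < u.length), u.get ⟨j, h⟩ = w (i + j)

/-- The finite word `u` has period `p` (with `1 ≤ p ≤ |u|`):
`u[i] = u[i+p]` for all `0 ≤ i < |u| - p`. -/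
def HasPeriod (u : List Bool) (p : ℕ) : Prop :=
  1 ≤ p ∧ p ≤ u.length ∧ ∀ i, i + p < u.length → u.getD i false = u.getD (i + p) false

/-- The least period of a finite word. -/
noncomputable def leastPeriod (u : List Bool) : ℕ := sInf {p | HasPeriod u p}

/-- The exponent of a nonempty finite word: its length divided by its least period. -/
noncomputable def exponent (u : List Bool) : ℚ := (u.length : ℚ) / (leastPeriod u : ℚ)

/-- A finite word avoids α-powers: no nonempty factor has exponent ≥ α. -/
def AvoidsPow (a : ℚ) (w : List Bool) : Prop :=
  ∀ u : List Bool, u ≠ [] → u <:+: w → exponent u < a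

/-- A finite word avoids α⁺-powers: no nonempty factor has exponent > α. -/
def AvoidsPowPlus (a : ℚ) (w : List Bool) : Prop :=
  ∀ u : List Bool, u ≠ [] → u <:+: w → exponent u ≤ a

/-- An infinite word avoids α-powers. -/
def AvoidsPowSeq (a : ℚ) (w : ℕ → Bool) : Prop :=
  ∀ u : List Bool, u ≠ [] → IsFactorSeq u w → exponent u < a

/-- An infinite word avoids α⁺-powers. -/
def AvoidsPowPlusSeq (a : ℚ) (w : ℕ → Bool) : Prop :=
  ∀ u : List Bool, u ≠ [] → IsFactorSeq u w → exponent u ≤ a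

/-- An overlap is a word of the form a x a x a, with a a single letter. -/
def IsOverlap (u : List Bool) : Prop :=
  ∃ (a : Bool) (x : List Bool), u = [a] ++ x ++ [a] ++ x ++ [a]

/-- Overlap-freeness for finite words. -/
def OverlapFree (w : List Bool) : Prop := ∀ u : List Bool, u <:+: w → ¬ IsOverlap u

/-- Overlap-freeness for infinite words. -/
def OverlapFreeSeq (w : ℕ → Bool) : Prop := ∀ u : List Bool, IsFactorSeq u w → ¬ IsOverlap u

/-- The Thue–Morse word t = 0110100110010110⋯ : t[n] = 1 iff the number of
ones in the binary expansion of n is odd. -/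
def thueMorse : ℕ → Bool := fun n => (Nat.digits 2 n).count 1 % 2 == 1

/-- The complement t̄ of the Thue–Morse word. -/
def tmbar : ℕ → Bool := fun n => ! thueMorse n

/-- The infinite word obtained by prepending the finite word `u` to `w`. -/
def appendSeq (u : List Bool) (w : ℕ → Bool) : ℕ → Bool :=
  fun n => if h : n < u.length then u.get ⟨n, h⟩ else w (n - u.length)

/-- Lexicographic order on infinite binary words (with 0 < 1). -/
def seqLE (v w : ℕ → Bool) : Prop :=
  v = w ∨ ∃ n : ℕ, (∀ i < n, v i = w i) ∧ v n = false ∧ w n = true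

/-- The word x₀ μ(x₁) μ²(x₂) ⋯ μ^{n-1}(x_{n-1}). -/
def restivoJoin (x : ℕ → List Bool) (n : ℕ) : List Bool :=
  ((List.range n).map (fun i => mu^[i] (x i))).flatten

/-- Finite Restivo words: x₀ μ(x₁) ⋯ μ^t(x_t) with all xᵢ ∈ S. -/
def IsRestivo (w : List Bool) : Prop :=
  ∃ (t : ℕ) (x : ℕ → List Bool), (∀ i ≤ t, x i ∈ S) ∧ w = restivoJoin x (t + 1)

/-- Infinite Restivo words: x₀ μ(x₁) μ²(x₂) ⋯ with all xᵢ ∈ S and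
infinitely many xᵢ nonempty. -/
def IsRestivoSeq (w : ℕ → Bool) : Prop :=
  ∃ x : ℕ → List Bool, (∀ i, x i ∈ S) ∧ (∀ N : ℕ, ∃ i ≥ N, x i ≠ []) ∧
    ∀ n : ℕ, PrefixSeq (restivoJoin x n) w

/-- The infinite word 001001 t̄. -/
def lexLeastWord : ℕ → Bool :=
  appendSeq [false, false, true, false, false, true] tmbar

/-- No window of length `2 * p + 1` of `w` has period `p`, for any `p > 0`. -/
def NoOverlap (w : ℕ → Bool) : Prop :=
  ∀ i p, 0 < p → ¬ ∀ j ≤ p, w (i + j) = w (i + j + p)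

theorem overlapFreeSeq_iff_noOverlap (w : ℕ → Bool) : OverlapFreeSeq w ↔ NoOverlap w := by
  constructor
  · intro h i p hp hper
    obtain ⟨q, rfl⟩ : ∃ q, p = q + 1 := ⟨p - 1, by omega⟩
    refine h ((List.range (2 * q + 3)).map fun j => w (i + j)) ⟨i, ?_⟩
      ⟨w i, (List.range q).map fun j => w (i + 1 + j), ?_⟩
    · intro j hj
      simp
    · apply List.ext_getElem
      · simp
        omega
      · intro j h₁ h₂
        simp only [List.length_map, List.length_range] at h₁
        have e₁ : ∀ k, k ≤ q + 1 → w (i + (k + (q + 1))) = w (i + k) := fun k hk => by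
          rw [hper k hk, Nat.add_assoc]
        simp only [List.getElem_map, List.getElem_range, List.getElem_append, List.length_append,
          List.length_cons, List.length_nil, List.length_map, List.length_range,
          List.getElem_singleton]
        split_ifs with c₁ c₂ c₃ c₄
        · congr 1; omega
        · congr 1; omega
        · have := e₁ 0 (by omega)
          rw [show j = 0 + (q + 1) by omega, this]; simp
        · have := e₁ (j - (q + 1)) (by omega)
          rw [show j = (j - (q + 1)) + (q + 1) by omega, this]
          congr 1; omega
        · rw [show j = (q + 1) + (q + 1) by omega, e₁ _ le_rfl]
          have := e₁ 0 (by omega)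
          simpa using this
  · rintro h u ⟨i, hu⟩ ⟨a, x, rfl⟩
    refine h i (x.length + 1) (by omega) fun j hj => ?_
    have h₁ := hu j (by simp; omega)
    have h₂ := hu (j + (x.length + 1)) (by simp; omega)
    rw [Nat.add_assoc, ← h₁, ← h₂]
    simp only [List.get_eq_getElem, List.getElem_append, List.length_append,
      List.length_cons, List.length_nil, List.getElem_singleton]
    grind

theorem NoOverlap.drop {w : ℕ → Bool} (h : NoOverlap w) (k : ℕ) :
    NoOverlap fun n => w (k + n) := by
  intro i p hp hper
  refine h (k + i) p hp fun j hj => ?_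
  simpa only [Nat.add_assoc] using hper j hj

/-- A sequence that is the image of `v` under the Thue–Morse morphism. -/
def IsMuImage (w v : ℕ → Bool) : Prop :=
  ∀ n, w (2 * n) = v n ∧ w (2 * n + 1) = !v n

/-- Overlaps in a morphic image have even period and descend to the preimage. -/
theorem IsMuImage.descend {w v : ℕ → Bool} (hw : IsMuImage w v) {i p : ℕ}
    (hper : ∀ j ≤ p, w (i + j) = w (i + j + p)) :
    p % 2 = 0 ∧ ∀ j ≤ p / 2, v (i / 2 + j) = v (i / 2 + j + p / 2) := by
  have hper' : ∀ k, i ≤ k → k ≤ i + p → w k = w (k + p) := fun k h₁ h₂ => by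
    have := hper (k - i) (by omega)
    rwa [show i + (k - i) = k by omega] at this
  have hev : ∀ k, k % 2 = 0 → w (k + 1) = !w k := fun k hk => by
    obtain ⟨m, rfl⟩ : ∃ m, k = 2 * m := ⟨k / 2, by omega⟩
    rw [(hw m).1, (hw m).2]
  have hp : p % 2 = 0 := by
    by_contra hodd
    have halt : ∀ k, i ≤ k → k < i + p → w (k + 1) = !w k := by
      intro k h₁ h₂
      by_cases hk : k % 2 = 0
      · exact hev k hk
      · rw [hper' k h₁ (by omega), hper' (k + 1) (by omega) (by omega),
          show k + 1 + p = k + p + 1 by omega]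
        exact hev _ (by omega)
    have hpar : ∀ k, k ≤ p → w (i + k) = (w i ^^ decide (k % 2 = 1)) := by
      intro k
      induction k with
      | zero => simp
      | succ k ih =>
        intro hk
        rw [← Nat.add_assoc, halt (i + k) (by omega) (by omega), ih (by omega)]
        rcases Nat.mod_two_eq_zero_or_one k with h | h
        · have : (k + 1) % 2 = 1 := by omega
          simp [h, this]
        · have : (k + 1) % 2 = 0 := by omega
          simp [h, this]
    have h₁ := hpar p le_rfl
    have h₂ := hper' i le_rfl (by omega)
    have h₃ : p % 2 = 1 := by omega
    rw [← h₂, h₃] at h₁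
    simp at h₁
  refine ⟨hp, fun j hj => ?_⟩
  by_cases hc : i ≤ 2 * (i / 2 + j)
  · have h := hper' (2 * (i / 2 + j)) hc (by omega)
    rwa [show 2 * (i / 2 + j) + p = 2 * (i / 2 + j + p / 2) by omega, (hw _).1, (hw _).1] at h
  · have h := hper' (2 * (i / 2 + j) + 1) (by omega) (by omega)
    rw [show 2 * (i / 2 + j) + 1 + p = 2 * (i / 2 + j + p / 2) + 1 by omega,
      (hw _).2, (hw _).2] at h
    simpa using h

theorem IsMuImage.noOverlap {w v : ℕ → Bool} (hw : IsMuImage w v) (hv : NoOverlap v) :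
    NoOverlap w := by
  intro i p hp hper
  obtain ⟨h₀, h₁⟩ := hw.descend hper
  exact hv _ _ (by omega) h₁

/-- The first letter of a morphic image may be deleted without losing overlaps. -/
theorem IsMuImage.noOverlap_of_tail {w v : ℕ → Bool} (hw : IsMuImage w v)
    (h : NoOverlap fun n => w (1 + n)) : NoOverlap v := by
  intro i p hp hper
  refine h (2 * i) (2 * p) (by omega) fun j hj => ?_
  beta_reduce
  have hk := hper ((j + 1) / 2) (by omega)
  rcases Nat.mod_two_eq_zero_or_one j with hj₂ | hj₂
  · rw [show 1 + (2 * i + j) = 2 * (i + (j + 1) / 2) + 1 by omega,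
      show 1 + (2 * i + j + 2 * p) = 2 * (i + (j + 1) / 2 + p) + 1 by omega,
      (hw _).2, (hw _).2, hk]
  · rw [show 1 + (2 * i + j) = 2 * (i + (j + 1) / 2) by omega,
      show 1 + (2 * i + j + 2 * p) = 2 * (i + (j + 1) / 2 + p) by omega,
      (hw _).1, (hw _).1, hk]

theorem isMuImage_tmbar : IsMuImage tmbar tmbar := by
  intro n
  constructor
  · rcases Nat.eq_zero_or_pos n with rfl | hn
    · rfl
    · have h := Nat.digits_add_two_add_one 0 (2 * n - 1)
      rw [show 2 * n - 1 + 1 = 2 * n by omega] at h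
      simp [tmbar, thueMorse, h]
  · have h := Nat.digits_add_two_add_one 0 (2 * n)
    have h₁ : (2 * n + 1) / 2 = n := by omega
    simp only [tmbar, thueMorse, h, Nat.zero_add, h₁]
    rcases Nat.mod_two_eq_zero_or_one (List.count 1 (Nat.digits 2 n)) with h₂ | h₂ <;>
      simp [Nat.add_mod, h₂]

theorem tmbar_zero : tmbar 0 = true := by simp [tmbar, thueMorse]

theorem tmbar_one : tmbar 1 = false := by
  simpa [tmbar_zero] using (isMuImage_tmbar 0).2

theorem tmbar_two : tmbar 2 = false := by
  simpa [tmbar_one] using (isMuImage_tmbar 1).1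

theorem isMuImage_appendSeq {u v : List Bool} {w w' : ℕ → Bool} (h : IsMuImage w w')
    (huv : u = mu v) : IsMuImage (appendSeq u w) (appendSeq v w') := by
  subst huv
  induction v with
  | nil => simpa [appendSeq, mu, IsMuImage] using h
  | cons b v ih =>
    intro n
    cases n with
    | zero => simp [appendSeq, mu]
    | succ n =>
      have := ih n
      simp only [appendSeq, mu, List.map_cons, List.flatten_cons, List.length_append] at this ⊢
      simp only [List.get_eq_getElem, List.length_cons, List.length_nil] at this ⊢
      simp [show 2 * (n + 1) = 2 * n + 1 + 1 by omega] at this ⊢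
      grind

theorem appendSeq_drop (u v : List Bool) (w : ℕ → Bool) :
    (fun n => appendSeq (u ++ v) w (u.length + n)) = appendSeq v w := by
  funext n
  simp [appendSeq, Nat.add_sub_add_left]

theorem noOverlap_appendSeq_right {u v : List Bool} {w : ℕ → Bool}
    (h : NoOverlap (appendSeq (u ++ v) w)) : NoOverlap (appendSeq v w) := by
  have := h.drop u.length
  rwa [appendSeq_drop] at this

theorem noOverlap_one_tmbar : NoOverlap (appendSeq [true] tmbar) := by
  have h₁ : IsMuImage (appendSeq [true, false] tmbar) (appendSeq [true] tmbar) :=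
    isMuImage_appendSeq isMuImage_tmbar rfl
  have h₂ : IsMuImage (appendSeq [true, false, false, true] tmbar)
      (appendSeq [true, false] tmbar) :=
    isMuImage_appendSeq isMuImage_tmbar rfl
  intro i p
  induction p using Nat.strong_induction_on generalizing i with
  | _ p ih =>
    intro hp hper
    have hd := appendSeq_drop [true, false, false] [true] tmbar
    have hper' : ∀ j ≤ p, appendSeq [true, false, false, true] tmbar (3 + i + j) =
        appendSeq [true, false, false, true] tmbar (3 + i + j + p) := by
      intro j hj
      have := hper j hj
      rw [← hd] at this
      simpa [Nat.add_assoc] using this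
    obtain ⟨h₃, h₄⟩ := h₂.descend hper'
    obtain ⟨h₅, h₆⟩ := h₁.descend h₄
    exact ih _ (by omega) _ (by omega) h₆

theorem noOverlap_append_tmbar :
    NoOverlap (appendSeq [false, true, false, false, true] tmbar) := by
  have h₁ : NoOverlap (appendSeq [true, false] tmbar) :=
    (isMuImage_appendSeq isMuImage_tmbar rfl).noOverlap noOverlap_one_tmbar
  have h₂ : NoOverlap (appendSeq [true, false, false, true] tmbar) :=
    (isMuImage_appendSeq isMuImage_tmbar rfl).noOverlap h₁
  have h₃ : NoOverlap (appendSeq [false, true] tmbar) :=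
    noOverlap_appendSeq_right (u := [true, false]) h₂
  have h₄ : NoOverlap (appendSeq [false, true, true, false] tmbar) :=
    (isMuImage_appendSeq isMuImage_tmbar rfl).noOverlap h₃
  have h₅ : NoOverlap
      (appendSeq [false, true, true, false, true, false, false, true] tmbar) :=
    (isMuImage_appendSeq isMuImage_tmbar rfl).noOverlap h₄
  exact noOverlap_appendSeq_right (u := [false, true, true]) h₅

theorem IsMuImage.odd_of_eq_succ {w v : ℕ → Bool} (hw : IsMuImage w v) {k : ℕ}
    (h : w k = w (k + 1)) : k % 2 = 1 := by
  by_contra hk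
  obtain ⟨m, rfl⟩ : ∃ m, k = 2 * m := ⟨k / 2, by omega⟩
  rw [(hw m).1, (hw m).2] at h
  simp at h

theorem lexLeastWord_add_six (n : ℕ) : lexLeastWord (n + 6) = tmbar n := by
  simp [lexLeastWord, appendSeq]

theorem noOverlap_lexLeastWord : NoOverlap lexLeastWord := by
  intro i p hp hper
  have e₀ : lexLeastWord 0 = false := rfl
  have e₁ : lexLeastWord 1 = false := rfl
  have e₂ : lexLeastWord 2 = true := rfl
  have e₃ : lexLeastWord 3 = false := rfl
  have e₄ : lexLeastWord 4 = false := rfl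
  have e₅ : lexLeastWord 5 = true := rfl
  have e₆ : lexLeastWord 6 = true := (lexLeastWord_add_six 0).trans tmbar_zero
  cases i with
  | succ i =>
    refine noOverlap_append_tmbar i p hp fun j hj => ?_
    have hd := appendSeq_drop [false] [false, true, false, false, true] tmbar
    rw [← hd]
    have := hper j hj
    simpa [lexLeastWord, Nat.add_comm 1, Nat.add_right_comm _ 1] using this
  | zero =>
    simp only [Nat.zero_add] at hper
    by_cases hp₆ : 6 ≤ p
    · obtain ⟨k, rfl⟩ : ∃ k, p = k + 6 := ⟨p - 6, by omega⟩
      have h : ∀ j ≤ 5, lexLeastWord j = tmbar (k + j) := fun j hj => by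
        rw [hper j (by omega), ← lexLeastWord_add_six]
        congr 1
        omega
      have h₁ := isMuImage_tmbar.odd_of_eq_succ (k := k)
        (by rw [← h 1 (by omega), e₁, ← e₀]; exact (h 0 (by omega)).symm)
      have h₂ := isMuImage_tmbar.odd_of_eq_succ (k := k + 3)
        (by rw [← h 3 (by omega), e₃, ← e₄]; exact h 4 (by omega))
      omega
    · have h₀ := hper 0 (by omega)
      have h₁ := hper 1 (by omega)
      interval_cases p
      · simp_all
      · simp_all
      · have h₃ := hper 3 (by omega)
        simp_all
      · have h₂ := hper 2 (by omega)
        simp_all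
      · simp_all

theorem NoOverlap.not_cube {w : ℕ → Bool} (h : NoOverlap w) (i : ℕ)
    (h₁ : w i = w (i + 1)) (h₂ : w (i + 1) = w (i + 2)) : False := by
  refine h i 1 one_pos fun j hj => ?_
  interval_cases j
  · exact h₁
  · exact h₂

theorem NoOverlap.ne_add_three_of_double {w : ℕ → Bool} (h : NoOverlap w) {k : ℕ}
    (hk : w (k + 1) = w (k + 2)) : w (k + 4) ≠ w (k + 5) := by
  intro hc
  have c₀ := h.not_cube k
  have c₁ := h.not_cube (k + 1) hk
  have c₃ := h.not_cube (k + 3)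
  have c₄ := h.not_cube (k + 4) hc
  refine h k 3 (by omega) fun j hj => ?_
  have b : ∀ x y z : Bool, x ≠ y → y ≠ z → x = z := by decide
  have c₀' : w k ≠ w (k + 1) := fun e => c₀ e hk
  have c₃' : w (k + 3) ≠ w (k + 4) := fun e => c₃ e hc
  have e₁ : w (k + 1) = w (k + 4) := b _ _ _ (hk ▸ c₁) c₃'
  interval_cases j
  · exact b _ _ _ (hk ▸ c₀') c₁
  · exact e₁
  · exact hk.symm.trans (e₁.trans hc)
  · exact b _ _ _ c₃' (hc ▸ c₄)

theorem NoOverlap.exists_next_double {w : ℕ → Bool} (h : NoOverlap w) {k : ℕ}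
    (hk : w (k + 1) = w (k + 2)) : w (k + 3) = w (k + 4) ∨ w (k + 5) = w (k + 6) := by
  by_contra! hc
  have c₁ := h.not_cube (k + 1) hk
  have hn := h.ne_add_three_of_double hk
  refine h (k + 2) 2 (by omega) fun j hj => ?_
  have b : ∀ x y z : Bool, x ≠ y → y ≠ z → x = z := by decide
  interval_cases j
  · exact b _ _ _ c₁ hc.1
  · exact b _ _ _ hc.1 hn
  · exact b _ _ _ hn hc.2

/-- Away from the first letter, a double letter determines a parsing of the rest of an
overlap-free word into the blocks `01` and `10`. -/
theorem NoOverlap.ne_succ_of_double {w : ℕ → Bool} (h : NoOverlap w) (n : ℕ) :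
    ∀ i, 1 ≤ i → w i = w (i + 1) → w (i + 1 + 2 * n) ≠ w (i + 2 + 2 * n) := by
  induction n using Nat.strong_induction_on with
  | _ n ih =>
    intro i hi hii
    obtain ⟨k, rfl⟩ : ∃ k, i = k + 1 := ⟨i - 1, by omega⟩
    match n, ih with
    | 0, _ => exact h.not_cube (k + 1) hii
    | 1, _ => exact h.ne_add_three_of_double hii
    | n + 2, ih =>
      rcases h.exists_next_double hii with hd | hd
      · have := ih (n + 1) (by omega) (k + 3) (by omega) hd
        rwa [show k + 3 + 1 + 2 * (n + 1) = k + 1 + 1 + 2 * (n + 2) by omega,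
          show k + 3 + 2 + 2 * (n + 1) = k + 1 + 2 + 2 * (n + 2) by omega] at this
      · have := ih n (by omega) (k + 5) (by omega) hd
        rwa [show k + 5 + 1 + 2 * n = k + 1 + 1 + 2 * (n + 2) by omega,
          show k + 5 + 2 + 2 * n = k + 1 + 2 + 2 * (n + 2) by omega] at this

/-- An overlap-free word whose second letter is `1` is, after deleting its first letter,
not smaller than the complement of the Thue–Morse word. -/
theorem NoOverlap.not_lt_tmbar (n : ℕ) : ∀ w : ℕ → Bool, NoOverlap w → w 1 = true →
    (∀ i < n, w (i + 1) = tmbar i) → w (n + 1) = false → tmbar n = true → False := by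
  induction n using Nat.strong_induction_on with
  | _ n ih =>
    intro w hw hw₁ hlt hwn htn
    have n₀ : n ≠ 0 := by rintro rfl; simp_all
    have n₁ : n ≠ 1 := by rintro rfl; simp [tmbar_one] at htn
    have n₂ : n ≠ 2 := by rintro rfl; simp [tmbar_two] at htn
    have w₂ : w 2 = false := (hlt 1 (by omega)).trans tmbar_one
    have w₃ : w 3 = false := (hlt 2 (by omega)).trans tmbar_two
    have hne : ∀ k, w (2 * k + 1) ≠ w (2 * k + 2) := by
      intro k
      cases k with
      | zero => simp [hw₁, w₂]
      | succ k =>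
        have := hw.ne_succ_of_double k 2 (by omega) (w₂.trans w₃.symm)
        rwa [show 2 + 1 + 2 * k = 2 * (k + 1) + 1 by omega,
          show 2 + 2 + 2 * k = 2 * (k + 1) + 2 by omega] at this
    let v : ℕ → Bool := fun k => if k = 0 then !w 0 else w (2 * k - 1)
    let w' : ℕ → Bool := fun k => if k = 0 then !w 0 else w (k - 1)
    have himg : IsMuImage w' v := by
      intro k
      cases k with
      | zero => simp [w', v]
      | succ k =>
        refine ⟨by simp [w', v], ?_⟩
        have := hne k
        simp only [w', v]
        simp only [Nat.add_eq_zero_iff, one_ne_zero, and_false, if_false]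
        rw [show 2 * (k + 1) + 1 - 1 = 2 * k + 2 by omega,
          show 2 * (k + 1) - 1 = 2 * k + 1 by omega]
        exact (Bool.eq_not_of_ne this.symm)
    have hv : NoOverlap v := himg.noOverlap_of_tail <| by
      have : (fun n => w' (1 + n)) = w := by
        funext n
        simp [w']
      rwa [this]
    have hvs : ∀ k, v (k + 1) = w (2 * k + 1) := fun k => by
      simp only [v, Nat.add_eq_zero_iff, one_ne_zero, and_false, if_false]
      rw [show 2 * (k + 1) - 1 = 2 * k + 1 by omega]
    rcases Nat.even_or_odd' n with ⟨m, rfl | rfl⟩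
    · refine ih m (by omega) v hv (by rw [hvs 0, hw₁]) (fun i hi => ?_) ?_ ?_
      · rw [hvs, hlt _ (by omega), (isMuImage_tmbar i).1]
      · rw [hvs, hwn]
      · rw [← htn, (isMuImage_tmbar m).1]
    · have h₁ := hlt (2 * m) (by omega)
      rw [(isMuImage_tmbar m).1] at h₁
      rw [(isMuImage_tmbar m).2] at htn
      apply hne m
      rw [h₁, hwn]
      simpa using htn

theorem not_lt_lexLeastWord {w : ℕ → Bool} (hw : NoOverlap w) (n : ℕ)
    (hlt : ∀ i < n, w i = lexLeastWord i) (hwn : w n = false)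
    (hn : lexLeastWord n = true) : False := by
  have e₀ : lexLeastWord 0 = false := rfl
  have e₁ : lexLeastWord 1 = false := rfl
  have e₂ : lexLeastWord 2 = true := rfl
  have e₃ : lexLeastWord 3 = false := rfl
  have e₄ : lexLeastWord 4 = false := rfl
  have e₅ : lexLeastWord 5 = true := rfl
  have e₆ : lexLeastWord 6 = true := (lexLeastWord_add_six 0).trans tmbar_zero
  by_cases h₆ : n < 6
  · interval_cases n
    · simp_all
    · simp_all
    · exact hw.not_cube 0 (by simp [hlt, e₀, e₁]) (by simp [hlt, e₁, hwn])
    · simp_all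
    · simp_all
    · exact hw.not_cube 3 (by simp [hlt, e₃, e₄]) (by simp [hlt, e₄, hwn])
  · obtain ⟨k, rfl⟩ : ∃ k, n = k + 6 := ⟨n - 6, by omega⟩
    cases k with
    | zero =>
      refine hw 0 3 (by omega) fun j hj => ?_
      interval_cases j <;> simp [hlt, e₀, e₁, e₂, e₃, e₄, e₅, hwn]
    | succ k =>
      refine NoOverlap.not_lt_tmbar (k + 1) _ (hw.drop 5) ?_ (fun i hi => ?_) ?_ ?_
      · simp [hlt, e₆]
      · rw [← lexLeastWord_add_six, ← hlt _ (by omega)]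
        congr 1
        omega
      · rw [← hwn]
        congr 1
        omega
      · rw [← hn, lexLeastWord_add_six]

/-- 001001 t̄ is overlap-free and is the lexicographically least infinite
overlap-free binary word. -/
theorem lexLeast_overlapFree :
    OverlapFreeSeq lexLeastWord ∧
    ∀ w : ℕ → Bool, OverlapFreeSeq w → seqLE lexLeastWord w := by
  refine ⟨(overlapFreeSeq_iff_noOverlap _).2 noOverlap_lexLeastWord, fun w hw => ?_⟩
  rw [overlapFreeSeq_iff_noOverlap] at hw
  by_cases heq : lexLeastWord = w
  · exact Or.inl heq
  · have hex : ∃ n, lexLeastWord n ≠ w n := Function.ne_iff.1 heq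
    have hmin : ∀ i < Nat.find hex, lexLeastWord i = w i := fun i hi =>
      not_not.1 (Nat.find_min hex hi)
    have hne := Nat.find_spec hex
    refine Or.inr ⟨Nat.find hex, hmin, ?_⟩
    cases h₁ : lexLeastWord (Nat.find hex) <;> cases h₂ : w (Nat.find hex)
    · exact absurd (h₁.trans h₂.symm) hne
    · exact ⟨rfl, rfl⟩
    · exact (not_lt_lexLeastWord hw _ (fun i hi => (hmin i hi).symm) h₂ h₁).elim
    · exact absurd (h₁.trans h₂.symm) hne
end

section
/- Let w be an infinite binary word that differs from the Thue–Morse word t in at least one but only finitely many positions (i.e., the set {n : w[n] ≠ t[n]} is finite and nonempty). Then w contains an overlap. -/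
theorem thueMorse_two_mul (n : ℕ) : thueMorse (2 * n) = thueMorse n := by
  rcases Nat.eq_zero_or_pos n with rfl | hn
  · rfl
  · simp [thueMorse, Nat.digits_def' one_lt_two (Nat.mul_pos two_pos hn)]

theorem thueMorse_two_mul_add_one (n : ℕ) : thueMorse (2 * n + 1) = !thueMorse n := by
  have h : Nat.digits 2 (2 * n + 1) = 1 :: Nat.digits 2 n := by
    rw [Nat.digits_def' one_lt_two (Nat.succ_pos _)]
    congr 1
    · lia
    · congr 1; lia
  simp only [thueMorse, h, List.count_cons_self]
  rcases Nat.mod_two_eq_zero_or_one ((Nat.digits 2 n).count 1) with h0 | h0 <;>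
    simp [Nat.add_mod, h0]

/-- The word `w` has an overlap of period `p` starting at position `i`. -/
def HasOverlapAt (w : ℕ → Bool) (i p : ℕ) : Prop :=
  1 ≤ p ∧ ∀ k ≤ p, w (i + k) = w (i + k + p)

theorem HasOverlapAt.exists_isOverlap {w : ℕ → Bool} {i p : ℕ} (h : HasOverlapAt w i p) :
    ∃ u : List Bool, IsFactorSeq u w ∧ IsOverlap u := by
  obtain ⟨hp, h⟩ := h
  refine ⟨(List.range (2 * p + 1)).map fun j => w (i + j), ⟨i, fun j hj => by simp⟩,
    w i, (List.range (p - 1)).map fun j => w (i + 1 + j), ?_⟩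
  apply List.ext_getElem
  · simp; lia
  · intro j h1 h2
    have hj : j < 2 * p + 1 := by simpa using h1
    simp only [List.getElem_map, List.getElem_range, List.getElem_append, List.length_append,
      List.length_cons, List.length_nil, List.length_map, List.length_range,
      List.getElem_singleton]
    have shift : p ≤ j → w (i + j) = w (i + (j - p)) := fun hpj =>
      (congrArg w (by lia)).trans (h (j - p) (by lia)).symm
    split_ifs
    · exact congrArg w (by lia)
    · exact congrArg w (by lia)
    · exact (shift (by lia)).trans (congrArg w (by lia))
    · exact (shift (by lia)).trans (congrArg w (by lia))
    · exact (shift (by lia)).trans ((congrArg w (by lia)).trans (h 0 p.zero_le).symm)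

/-- In an overlap-free word, `aa` cannot occur at positions `2m, 2m + 1` with `m ≥ 1` when it is
followed by two blocks of the form `b b̄`. -/
theorem block_ne_of_no_overlap {w : ℕ → Bool} (hw : ∀ i p, ¬ HasOverlapAt w i p) {m : ℕ}
    (hm : 1 ≤ m) (h1 : w (2 * (m + 1)) ≠ w (2 * (m + 1) + 1))
    (h2 : w (2 * (m + 2)) ≠ w (2 * (m + 2) + 1)) : w (2 * m) ≠ w (2 * m + 1) := by
  intro h0
  obtain ⟨s, hs⟩ : ∃ s, 2 * m = s + 1 := ⟨2 * m - 1, by lia⟩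
  have e1 : 2 * (m + 1) = s + 3 := by lia
  have e2 : 2 * (m + 2) = s + 5 := by lia
  rw [e1] at h1
  rw [e2] at h2
  rw [hs] at h0
  have cube (i : ℕ) (ha : w i = w (i + 1)) (hb : w (i + 1) = w (i + 2)) : False := by
    refine hw i 1 ⟨le_rfl, fun k hk => ?_⟩
    interval_cases k <;> assumption
  have period_two (ha : w (s + 2) = w (s + 4)) (hb : w (s + 3) = w (s + 5))
      (hc : w (s + 4) = w (s + 6)) : False := by
    refine hw (s + 2) 2 ⟨by lia, fun k hk => ?_⟩
    interval_cases k <;> assumption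
  have period_three (ha : w s = w (s + 3)) (hb : w (s + 1) = w (s + 4))
      (hc : w (s + 2) = w (s + 5)) (hd : w (s + 3) = w (s + 6)) : False := by
    refine hw s 3 ⟨by lia, fun k hk => ?_⟩
    interval_cases k <;> assumption
  have c0 := cube s
  have c1 := cube (s + 1)
  simp only [add_assoc, Nat.reduceAdd] at *
  revert h0 h1 h2 c0 c1 period_two period_three
  cases w s <;> cases w (s + 1) <;> cases w (s + 2) <;> cases w (s + 3) <;> cases w (s + 4) <;>
    cases w (s + 5) <;> cases w (s + 6) <;> simp

theorem eq_thueMorse_of_no_overlap (M : ℕ) : ∀ w : ℕ → Bool, (∀ n ≥ M, w n = thueMorse n) →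
    (∀ i p, ¬ HasOverlapAt w i p) → ∀ n, w n = thueMorse n := by
  induction M using Nat.strong_induction_on with
  | _ M ih =>
    intro w hM hw
    rcases Nat.eq_zero_or_pos M with rfl | hpos
    · exact fun n => hM n n.zero_le
    have blocks (d : ℕ) : ∀ m ≥ 1, M ≤ m + d → w (2 * m) ≠ w (2 * m + 1) := by
      induction d with
      | zero =>
        intro m _ hm
        rw [hM _ (by lia), hM _ (by lia), thueMorse_two_mul, thueMorse_two_mul_add_one]
        simp
      | succ d ihd =>
        intro m h1 hm
        exact block_ne_of_no_overlap hw h1 (ihd _ (by lia) (by lia)) (ihd _ (by lia) (by lia))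
    have heven (m : ℕ) (hm : 1 ≤ m) : w (2 * m) = !w (2 * m + 1) :=
      Bool.eq_not_iff.mpr (blocks M m hm (by lia))
    -- Away from position `0`, the word `w` is the image under `μ` of `fun m => !w (2 * m + 1)`.
    have key : ∀ m, (!w (2 * m + 1)) = thueMorse m := by
      refine ih (M / 2) (by lia) (fun m => !w (2 * m + 1)) (fun n hn => ?_) ?_
      · rw [hM _ (by lia), thueMorse_two_mul_add_one, Bool.not_not]
      · rintro i p ⟨hp, h⟩
        refine hw (2 * i + 1) (2 * p) ⟨by lia, fun k hk => ?_⟩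
        obtain ⟨j, rfl | rfl⟩ := Nat.even_or_odd' k
        · have := h j (by lia)
          rw [show 2 * i + 1 + 2 * j = 2 * (i + j) + 1 by ring,
            show 2 * (i + j) + 1 + 2 * p = 2 * (i + j + p) + 1 by ring]
          simpa using this
        · have := h (j + 1) (by lia)
          rw [show 2 * i + 1 + (2 * j + 1) = 2 * (i + (j + 1)) by ring,
            show 2 * (i + (j + 1)) + 2 * p = 2 * (i + (j + 1) + p) by ring,
            heven _ (by lia), heven _ (by lia)]
          exact this
    have hsucc (n : ℕ) (hn : 1 ≤ n) : w n = thueMorse n := by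
      obtain ⟨m, rfl | rfl⟩ := Nat.even_or_odd' n
      · rw [heven m (by lia), key, thueMorse_two_mul]
      · rw [thueMorse_two_mul_add_one, ← key, Bool.not_not]
    intro n
    rcases Nat.eq_zero_or_pos n with rfl | hn
    · by_contra h0
      have t0 : thueMorse 0 = false := by simp [thueMorse]
      have w0 : w 0 = true := by simpa [t0] using h0
      have w1 : w 1 = true := by rw [hsucc 1 le_rfl]; simp [thueMorse]
      have w2 : w 2 = true := by rw [hsucc 2 (by lia)]; simp [thueMorse]
      refine hw 0 1 ⟨le_rfl, fun k hk => ?_⟩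
      interval_cases k
      · exact w0.trans w1.symm
      · exact w1.trans w2.symm
    · exact hsucc n hn

/-- Flipping at least one but only finitely many bits of the Thue–Morse word
produces a word with an overlap. -/
theorem flip_thueMorse_has_overlap (w : ℕ → Bool)
    (hfin : {n : ℕ | w n ≠ thueMorse n}.Finite)
    (hne : {n : ℕ | w n ≠ thueMorse n}.Nonempty) :
    ∃ u : List Bool, IsFactorSeq u w ∧ IsOverlap u := by
  by_contra hno
  obtain ⟨n, hn⟩ := hne
  obtain ⟨B, hB⟩ := hfin.bddAbove
  refine hn (eq_thueMorse_of_no_overlap (B + 1) w (fun m hm => ?_)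
    (fun i p h => hno h.exists_isOverlap) n)
  by_contra h
  have : m ≤ B := hB h
  lia
end

section
/- There exists an uncountable set W of infinite binary words such that every w ∈ W avoids 7/3-powers and contains arbitrarily large overlaps; that is, for every w ∈ W and every N, the word w has an overlap factor of length greater than N. -/
/-- The factor of `w` of length `N` starting at position `i` has period `p`. -/
def PeriodOn (w : ℕ → Bool) (i p N : ℕ) : Prop :=
  ∀ j, j + p < N → w (i + j) = w (i + j + p)

lemma PeriodOn.drop {w : ℕ → Bool} {i p N : ℕ} (h : PeriodOn w i p N) (d : ℕ) :
    PeriodOn w (i + d) p (N - d) := by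
  intro j hj
  have := h (d + j) (by omega)
  rwa [← add_assoc] at this

/-- `W n = (c n) ^ (L n) · μ (W (n + 1))` for all `n`, where exponents and letters satisfy local
conditions that exclude `7/3`-powers. -/
structure IsTower (L : ℕ → ℕ) (c : ℕ → Bool) (W : ℕ → ℕ → Bool) : Prop where
  length_le : ∀ n, L n ≤ 2
  head : ∀ n i, i < L n → W n i = c n
  even : ∀ n j, W n (L n + 2 * j) = W (n + 1) j
  odd : ∀ n j, W n (L n + 2 * j + 1) = !W (n + 1) j
  of_two : ∀ n, L n = 2 →
    W (n + 1) 0 = (!c n) ∧ W (n + 1) 1 = c n ∧ W (n + 1) 2 = (!c n)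
  of_pos : ∀ n, 1 ≤ L n → ¬ (W (n + 1) 0 = (!c n) ∧ W (n + 1) 1 = (!c n))
  of_succ : ∀ n, 1 ≤ L n → L (n + 1) = 1 → c (n + 1) ≠ c n

namespace IsTower

variable {L : ℕ → ℕ} {c : ℕ → Bool} {W : ℕ → ℕ → Bool}

lemma halve (hW : IsTower L c W) {n s q N : ℕ} (hN : 2 * q < N)
    (h : PeriodOn (W n) (L n + s) (2 * q) N) :
    PeriodOn (W (n + 1)) (s / 2) q ((s % 2 + N + 1) / 2) := by
  intro j hj
  rcases Nat.mod_two_eq_zero_or_one s with hs | hs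
  · have h1 := h (2 * j) (by omega)
    rwa [show L n + s + 2 * j = L n + 2 * (s / 2 + j) by omega,
      show L n + 2 * (s / 2 + j) + 2 * q = L n + 2 * (s / 2 + j + q) by omega,
      hW.even, hW.even] at h1
  · rcases Nat.eq_zero_or_pos j with rfl | hj0
    · have h1 := h 0 (by omega)
      rw [show L n + s + 0 = L n + 2 * (s / 2 + 0) + 1 by omega,
        show L n + 2 * (s / 2 + 0) + 1 + 2 * q = L n + 2 * (s / 2 + 0 + q) + 1 by omega,
        hW.odd, hW.odd] at h1
      simpa using h1
    · have h1 := h (2 * j - 1) (by omega)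
      rwa [show L n + s + (2 * j - 1) = L n + 2 * (s / 2 + j) by omega,
        show L n + 2 * (s / 2 + j) + 2 * q = L n + 2 * (s / 2 + j + q) by omega,
        hW.even, hW.even] at h1

lemma exists_cube_of_odd (hW : IsTower L c W) {n a k N : ℕ} (hN : 2 * k + 5 ≤ N)
    (h : PeriodOn (W n) (L n + 2 * a) (2 * k + 1) N) :
    PeriodOn (W (n + 1)) (a + k) 1 3 := by
  have h0 := h 0 (by omega)
  have h1 := h 1 (by omega)
  have h2 := h 2 (by omega)
  have h3 := h 3 (by omega)
  rw [show L n + 2 * a + 0 = L n + 2 * a by omega,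
    show L n + 2 * a + (2 * k + 1) = L n + 2 * (a + k) + 1 by omega, hW.even, hW.odd] at h0
  rw [show L n + 2 * a + 1 + (2 * k + 1) = L n + 2 * (a + k + 1) by omega,
    hW.even, hW.odd] at h1
  rw [show L n + 2 * a + 2 + (2 * k + 1) = L n + 2 * (a + k + 1) + 1 by omega,
    show L n + 2 * a + 2 = L n + 2 * (a + 1) by omega, hW.even, hW.odd] at h2
  rw [show L n + 2 * a + 3 + (2 * k + 1) = L n + 2 * (a + k + 2) by omega,
    show L n + 2 * a + 3 = L n + 2 * (a + 1) + 1 by omega, hW.even, hW.odd] at h3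
  intro j hj
  have hj' : j = 0 ∨ j = 1 := by omega
  rcases hj' with rfl | rfl
  · simp only [add_zero]
    rw [← h1, h0, Bool.not_not]
  · rw [← h3, h2, Bool.not_not]

lemma exists_align (hW : IsTower L c W) (n i : ℕ) :
    ∃ a d, i + d = L n + 2 * a ∧ d ≤ 2 ∧ (L n ≤ i + 1 → d ≤ 1) := by
  have := hW.length_le n
  by_cases h : L n ≤ i
  · exact ⟨(i - L n + 1) / 2, (i - L n) % 2, by omega, by omega, by omega⟩
  · exact ⟨0, L n - i, by omega, by omega, by omega⟩

lemma cube_of_odd (hW : IsTower L c W) {n i k N : ℕ} (hk : 2 ≤ k) (hN : 2 * k + 7 ≤ N)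
    (h : PeriodOn (W n) i (2 * k + 1) N) : ∃ a, PeriodOn (W (n + 1)) a 1 3 := by
  obtain ⟨a, d, had, hd, -⟩ := hW.exists_align n i
  have h' := h.drop d
  rw [had] at h'
  exact ⟨_, hW.exists_cube_of_odd (by omega) h'⟩

lemma not_periodOn_one (hW : IsTower L c W) (n i : ℕ) : ¬ PeriodOn (W n) i 1 3 := by
  intro h
  by_cases hL : L n ≤ i + 1
  · obtain ⟨a, d, had, -, hd⟩ := hW.exists_align n i
    have h1 := h d (by have := hd hL; omega)
    rw [had, hW.even, hW.odd] at h1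
    simp at h1
  · have := hW.length_le n
    have hL2 : L n = 2 := by omega
    obtain rfl : i = 0 := by omega
    have h1 := h 1 (by omega)
    have e := hW.even n 0
    rw [hL2] at e
    simp only [zero_add, mul_zero, add_zero, Nat.reduceAdd] at h1 e
    rw [hW.head n 1 (by omega), e, (hW.of_two n hL2).1] at h1
    simp at h1

lemma not_periodOn_three (hW : IsTower L c W) (n i : ℕ) : ¬ PeriodOn (W n) i 3 7 := by
  intro h
  by_cases hL : L n ≤ i + 1
  · obtain ⟨a, d, had, -, hd⟩ := hW.exists_align n i
    have hd := hd hL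
    have h' := h.drop d
    rw [had] at h'
    have h0 := h' 0 (by omega)
    have h1 := h' 1 (by omega)
    have h2 := h' 2 (by omega)
    rw [show L n + 2 * a + 0 = L n + 2 * a by omega,
      show L n + 2 * a + 3 = L n + 2 * (a + 1) + 1 by omega, hW.even, hW.odd] at h0
    rw [show L n + 2 * a + 1 + 3 = L n + 2 * (a + 2) by omega, hW.even, hW.odd] at h1
    rw [show L n + 2 * a + 2 + 3 = L n + 2 * (a + 2) + 1 by omega,
      show L n + 2 * a + 2 = L n + 2 * (a + 1) by omega, hW.even, hW.odd, ← h1, h0] at h2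
    simp at h2
  · have := hW.length_le n
    have hL2 : L n = 2 := by omega
    obtain rfl : i = 0 := by omega
    have h3 := h 3 (by omega)
    have e := hW.odd n 0
    have e' := hW.even n 2
    rw [hL2] at e e'
    simp only [zero_add, mul_zero, add_zero, Nat.reduceAdd, Nat.reduceMul] at h3 e e'
    rw [e, e', (hW.of_two n hL2).1, (hW.of_two n hL2).2.2] at h3
    simp at h3

/-- `W (n + 1)` has no prefix of length `7 * r + 2` and period `3 * r + 1` that stays periodic
when the complement of the nonempty `n`-th block's letter is prepended. -/
lemma not_prefix_run (hW : IsTower L c W) {n r : ℕ} (hn : 1 ≤ L n)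
    (ih : ∀ q, 1 ≤ q → q < 2 * (3 * r + 1) → ∀ m i N, 7 * q ≤ 3 * N → ¬ PeriodOn (W m) i q N)
    (h : PeriodOn (W (n + 1)) 0 (3 * r + 1) (7 * r + 2)) (hc : W (n + 1) (3 * r) = !c n) :
    False := by
  rcases Nat.eq_zero_or_pos r with rfl | hr
  · have h0 := h 0 (by omega)
    simp only [zero_add, mul_zero, add_zero] at h0 hc
    exact hW.of_pos n hn ⟨hc, h0 ▸ hc⟩
  have hle := hW.length_le (n + 1)
  rcases Nat.even_or_odd' (3 * r + 1) with ⟨s, hs | hs⟩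
  · have h0 := h 0 (by omega)
    rw [zero_add, zero_add, hs] at h0
    have hL : L (n + 1) = 0 ∨ L (n + 1) = 1 ∨ L (n + 1) = 2 := by omega
    rcases hL with hL | hL | hL
    · rw [hs, show (0 : ℕ) = L (n + 1) + 0 by omega] at h
      exact ih s (by omega) (by omega) _ _ _ (by omega) (hW.halve (by omega) h)
    · have e := hW.even (n + 1) (s - 1)
      have e' := hW.odd (n + 1) (s - 1)
      rw [show L (n + 1) + 2 * (s - 1) = 3 * r by omega] at e e'
      rw [hs] at e'
      rw [hW.head (n + 1) 0 (by omega), e', ← e, hc, Bool.not_not] at h0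
      exact hW.of_succ n hn hL h0
    · have h1 := h 1 (by omega)
      have e := hW.even (n + 1) (s - 1)
      have e' := hW.odd (n + 1) (s - 1)
      rw [show L (n + 1) + 2 * (s - 1) = 2 * s by omega] at e e'
      rw [zero_add, hs, add_comm 1, e', hW.head (n + 1) 1 (by omega)] at h1
      rw [e, hW.head (n + 1) 0 (by omega), h1] at h0
      simp at h0
  · rw [hs] at h
    obtain ⟨a, ha⟩ := hW.cube_of_odd (by omega) (by omega) h
    exact ih 1 (by omega) (by omega) _ _ _ (by omega) ha

theorem not_periodOn (hW : IsTower L c W) :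
    ∀ p, 1 ≤ p → ∀ n i N, 7 * p ≤ 3 * N → ¬ PeriodOn (W n) i p N := by
  intro p
  induction p using Nat.strong_induction_on with
  | _ p ih =>
  intro hp n i N hN h
  have hle := hW.length_le n
  have mono : ∀ {w : ℕ → Bool} {i q M M' : ℕ}, M' ≤ M → PeriodOn w i q M → PeriodOn w i q M' :=
    fun hM hw j hj => hw j (by omega)
  rcases Nat.even_or_odd' p with ⟨q, rfl | rfl⟩
  · by_cases hi : L n ≤ i
    · obtain ⟨s, rfl⟩ := Nat.exists_eq_add_of_le hi
      exact ih q (by omega) (by omega) _ _ _ (by omega) (hW.halve (by omega) h)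
    by_cases hi1 : L n = i + 1
    · have h0 := h 0 (by omega)
      have e := hW.odd n (q - 1)
      rw [show L n + 2 * (q - 1) + 1 = i + 0 + 2 * q by omega] at e
      rw [e, hW.head n _ (by omega)] at h0
      have hd := h.drop 1
      rw [← hi1, show L n = L n + 0 by omega] at hd
      have hh := hW.halve (by omega) hd
      rw [show (0 % 2 + (N - 1) + 1) / 2 = N / 2 by omega, Nat.zero_div] at hh
      by_cases hq : 7 * q ≤ 3 * (N / 2)
      · exact ih q (by omega) (by omega) _ _ _ hq hh
      · obtain ⟨r, rfl⟩ : ∃ r, q = 3 * r + 1 := ⟨q / 3, by omega⟩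
        rw [show N / 2 = 7 * r + 2 by omega] at hh
        refine hW.not_prefix_run (by omega) (fun q hq hlt => ih q hlt hq) hh ?_
        rw [h0, Bool.not_not, Nat.add_sub_cancel]
    · have hL2 : L n = 2 := by omega
      obtain rfl : i = 0 := by omega
      have h0 := h 0 (by omega)
      have h1 := h 1 (by omega)
      have e := hW.even n (q - 1)
      have e' := hW.odd n (q - 1)
      rw [show L n + 2 * (q - 1) = 2 * q by omega] at e e'
      rw [zero_add, add_comm 1, e', hW.head n 1 (by omega)] at h1
      rw [zero_add, zero_add, e, hW.head n 0 (by omega), h1] at h0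
      simp at h0
  · have hq : q = 0 ∨ q = 1 ∨ 2 ≤ q := by omega
    rcases hq with rfl | rfl | hq
    · exact hW.not_periodOn_one n i (mono (by omega) h)
    · exact hW.not_periodOn_three n i (mono (by omega) h)
    · obtain ⟨a, ha⟩ := hW.cube_of_odd hq (by omega) h
      exact ih 1 (by omega) (by omega) _ _ _ (by omega) ha

lemma exists_periodOn_zero (hW : IsTower L c W) {n p : ℕ} :
    ∀ {i}, PeriodOn (W n) i p (2 * p + 1) →
      ∃ i, PeriodOn (W 0) i (2 ^ n * p) (2 * (2 ^ n * p) + 1) := by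
  induction n generalizing p with
  | zero => intro i h; exact ⟨i, by simpa using h⟩
  | succ n ih =>
    intro i h
    have h' : PeriodOn (W n) (L n + 2 * i) (2 * p) (2 * (2 * p) + 1) := by
      intro j hj
      rcases Nat.even_or_odd' j with ⟨k, rfl | rfl⟩
      · rw [show L n + 2 * i + 2 * k = L n + 2 * (i + k) by omega,
          show L n + 2 * (i + k) + 2 * p = L n + 2 * (i + k + p) by omega, hW.even, hW.even]
        exact h k (by omega)
      · rw [show L n + 2 * i + (2 * k + 1) = L n + 2 * (i + k) + 1 by omega,
          show L n + 2 * (i + k) + 1 + 2 * p = L n + 2 * (i + k + p) + 1 by omega,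
          hW.odd, hW.odd, h k (by omega)]
    have := ih h'
    rwa [← mul_assoc, ← pow_succ] at this

lemma overlap (hW : IsTower L c W) {n : ℕ} (h0 : L n = 1) (h1 : L (n + 1) = 2)
    (hc : c n = c (n + 1)) : PeriodOn (W n) 0 6 13 := by
  obtain ⟨a0, a1, a2⟩ := hW.of_two _ h1
  have b0 := hW.head (n + 1) 0 (by omega)
  have b1 := hW.head (n + 1) 1 (by omega)
  have e0 := hW.even (n + 1) 0
  have e1 := hW.even (n + 1) 1
  have o0 := hW.odd (n + 1) 0
  have o1 := hW.odd (n + 1) 1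
  have z := hW.head n 0 (by omega)
  have E := hW.even n
  have O := hW.odd n
  rw [h1] at e0 e1 o0 o1
  simp only [h0] at E O
  have E0 := E 0
  have E1 := E 1
  have E2 := E 2
  have E3 := E 3
  have E4 := E 4
  have E5 := E 5
  have O0 := O 0
  have O1 := O 1
  have O2 := O 2
  have O3 := O 3
  have O4 := O 4
  have O5 := O 5
  simp only [mul_zero, add_zero, mul_one, Nat.reduceAdd, Nat.reduceMul] at *
  intro j hj
  have hj : j < 7 := by omega
  interval_cases j <;> simp [*]

end IsTower

/-- The exponent and letter of the `n`-th block. The blocks come in groups of five, either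
`0, 00, 1, ε, ε` or `ε, 0, 00, 1, ε`; for an empty block the letter is the first letter of the
word that follows. -/
def blockCode (b : ℕ → Bool) (n : ℕ) : ℕ × Bool :=
  match b (n / 5), n % 5 with
  | false, 0 => (1, false)
  | false, 1 => (2, false)
  | false, 2 => (1, true)
  | true, 1 => (1, false)
  | true, 2 => (2, false)
  | true, 3 => (1, true)
  | _, _ => (0, false)

/-- The words `W n = (c n) ^ (L n) · μ (W (n + 1))` with `(L n, c n) = blockCode b n`. -/
def towerWord (b : ℕ → Bool) (n : ℕ) : ℕ → Bool
  | 0 => (blockCode b n).2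
  | i + 1 =>
    if i + 1 < (blockCode b n).1 then (blockCode b n).2
    else xor (towerWord b (n + 1) ((i + 1 - (blockCode b n).1) / 2))
      ((i + 1 - (blockCode b n).1) % 2 == 1)
  termination_by i => i
  decreasing_by omega

lemma towerWord_zero (b : ℕ → Bool) (n : ℕ) : towerWord b n 0 = (blockCode b n).2 := by
  rw [towerWord]

lemma blockCode_five (b : ℕ → Bool) (k : ℕ) :
    (b k = false ∧ blockCode b (5 * k) = (1, false) ∧ blockCode b (5 * k + 1) = (2, false) ∧
      blockCode b (5 * k + 2) = (1, true) ∧ blockCode b (5 * k + 3) = (0, false) ∧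
      blockCode b (5 * k + 4) = (0, false) ∨
    b k = true ∧ blockCode b (5 * k) = (0, false) ∧ blockCode b (5 * k + 1) = (1, false) ∧
      blockCode b (5 * k + 2) = (2, false) ∧ blockCode b (5 * k + 3) = (1, true) ∧
      blockCode b (5 * k + 4) = (0, false)) ∧ (blockCode b (5 * k + 5)).2 = false := by
  have d (r : ℕ) (hr : r < 5) : (5 * k + r) / 5 = k ∧ (5 * k + r) % 5 = r := by omega
  refine ⟨?_, ?_⟩
  · cases hb : b k
    all_goals
      simp [blockCode, hb, (d 1 (by omega)).1, (d 2 (by omega)).1, (d 3 (by omega)).1,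
        (d 4 (by omega)).1]
  · have h1 : (5 * k + 5) % 5 = 0 := by omega
    rw [blockCode, h1]
    cases b ((5 * k + 5) / 5) <;> rfl

lemma exists_five_mul (n : ℕ) :
    ∃ k, n = 5 * k ∨ n = 5 * k + 1 ∨ n = 5 * k + 2 ∨ n = 5 * k + 3 ∨ n = 5 * k + 4 :=
  ⟨n / 5, by omega⟩

/-- Transitions between consecutive blocks. -/
lemma blockCode_cases (b : ℕ → Bool) (n : ℕ) :
    (blockCode b n = (0, false) ∧ (blockCode b (n + 1)).2 = false) ∨
    (blockCode b n = (1, false) ∧ blockCode b (n + 1) = (2, false)) ∨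
    (blockCode b n = (2, false) ∧ blockCode b (n + 1) = (1, true) ∧
      (blockCode b (n + 2)).2 = false) ∨
    (blockCode b n = (1, true) ∧ blockCode b (n + 1) = (0, false) ∧
      (blockCode b (n + 2)).2 = false) := by
  obtain ⟨k, hk⟩ := exists_five_mul n
  obtain ⟨h | h, h5⟩ := blockCode_five b k <;> obtain ⟨-, h0, h1, h2, h3, h4⟩ := h <;>
    rcases hk with rfl | rfl | rfl | rfl | rfl <;> simp [*, add_assoc]

lemma towerWord_head (b : ℕ → Bool) (n i : ℕ) (hi : i < (blockCode b n).1) :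
    towerWord b n i = (blockCode b n).2 := by
  cases i with
  | zero => exact towerWord_zero b n
  | succ i => rw [towerWord, if_pos hi]

lemma towerWord_add (b : ℕ → Bool) (n j : ℕ) :
    towerWord b n ((blockCode b n).1 + j) = xor (towerWord b (n + 1) (j / 2)) (j % 2 == 1) := by
  cases h : (blockCode b n).1 + j with
  | zero =>
    have h0 : (blockCode b n).1 = 0 := by omega
    obtain rfl : j = 0 := by omega
    rw [towerWord_zero]
    rcases blockCode_cases b n with h | h | h | h <;> simp_all [towerWord_zero]
  | succ i =>
    rw [towerWord, if_neg (by omega), ← h, Nat.add_sub_cancel_left]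

lemma isTower_towerWord (b : ℕ → Bool) :
    IsTower (fun n => (blockCode b n).1) (fun n => (blockCode b n).2) (towerWord b) := by
  have even (n j : ℕ) :
      towerWord b n ((blockCode b n).1 + 2 * j) = towerWord b (n + 1) j := by
    rw [towerWord_add]; simp
  have odd (n j : ℕ) :
      towerWord b n ((blockCode b n).1 + 2 * j + 1) = !towerWord b (n + 1) j := by
    rw [add_assoc, towerWord_add, show (2 * j + 1) / 2 = j by omega]; simp
  refine ⟨fun n => ?_, towerWord_head b, even, odd, fun n hn => ?_, fun n hn => ?_,
    fun n hn hn' => ?_⟩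
  · rcases blockCode_cases b n with h | h | h | h <;> simp [h]
  · have e := even (n + 1) 0
    have o := odd (n + 1) 0
    have z := towerWord_zero b (n + 1)
    have z' := towerWord_zero b (n + 2)
    rcases blockCode_cases b n with h | h | h | h <;> simp_all
  · have e := even (n + 1) 0
    have o := odd (n + 1) 0
    have z := towerWord_zero b (n + 1)
    have z' := towerWord_zero b (n + 2)
    rcases blockCode_cases b n with h | h | h | h <;> simp_all
  · rcases blockCode_cases b n with h | h | h | h <;> simp_all

lemma towerWord_five_mul_one (b : ℕ → Bool) (k : ℕ) : towerWord b (5 * k) 1 = b k := by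
  have hW := isTower_towerWord b
  have e := hW.even (5 * k) 0
  have o := hW.odd (5 * k) 0
  have z := towerWord_zero b (5 * k + 1)
  obtain ⟨h | h, -⟩ := blockCode_five b k <;> simp_all

lemma towerWord_injective : Function.Injective fun b => towerWord b 0 := by
  intro b b' h
  have key : ∀ n, towerWord b n = towerWord b' n := by
    intro n
    induction n using Nat.strong_induction_on with
    | _ n ih =>
    cases n with
    | zero => exact h
    | succ n =>
      have hb : b (n / 5) = b' (n / 5) := by
        rw [← towerWord_five_mul_one b, ← towerWord_five_mul_one b', ih _ (by omega)]
      have hc : blockCode b n = blockCode b' n := by simp only [blockCode, hb]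
      funext j
      have e := (isTower_towerWord b).even n j
      have e' := (isTower_towerWord b').even n j
      rw [← e, ← e', hc, ih n (by omega)]
  funext k
  rw [← towerWord_five_mul_one b, ← towerWord_five_mul_one b', key]

lemma avoidsPowSeq_of_not_periodOn {w : ℕ → Bool}
    (h : ∀ p, 1 ≤ p → ∀ i N, 7 * p ≤ 3 * N → ¬ PeriodOn w i p N) : AvoidsPowSeq (7 / 3) w := by
  rintro u hu ⟨i, hi⟩
  have hlen : 1 ≤ u.length := List.length_pos_iff.mpr hu
  have hmem : leastPeriod u ∈ {p | HasPeriod u p} :=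
    Nat.sInf_mem ⟨u.length, hlen, le_rfl, fun j hj => by omega⟩
  obtain ⟨hp, -, hper⟩ := hmem
  have hp' : (0 : ℚ) < leastPeriod u := by exact_mod_cast hp
  rw [exponent, div_lt_iff₀ hp']
  by_contra! hle
  refine h _ hp i u.length ?_ fun j hj => ?_
  · have : (7 : ℚ) * leastPeriod u ≤ 3 * u.length := by linarith
    exact_mod_cast this
  · have h1 := hi j (by omega)
    have h2 := hi (j + leastPeriod u) hj
    have h3 := hper j hj
    rw [List.getD_eq_getElem _ _ (by omega), List.getD_eq_getElem _ _ hj] at h3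
    rw [add_assoc, ← h1, ← h2]
    exact h3

lemma exists_isOverlap_of_periodOn {w : ℕ → Bool} {i p : ℕ} (hp : 1 ≤ p)
    (h : PeriodOn w i p (2 * p + 1)) :
    ∃ u : List Bool, IsFactorSeq u w ∧ IsOverlap u ∧ u.length = 2 * p + 1 := by
  obtain ⟨q, rfl⟩ : ∃ q, p = q + 1 := ⟨p - 1, by omega⟩
  set x := (List.range q).map fun j => w (i + 1 + j) with hx
  have hxl : x.length = q := by simp [hx]
  have hl : ([w i] ++ x ++ [w i] ++ x ++ [w i]).length = 2 * (q + 1) + 1 := by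
    simp [hxl]; omega
  have hxj : ∀ j (hj : j < x.length), x[j] = w (i + 1 + j) := by intro j hj; simp [hx]
  have h0 : w i = w (i + (q + 1)) := h 0 (by omega)
  have h1 : w (i + (q + 1)) = w (i + (q + 1) + (q + 1)) := h (q + 1) (by omega)
  refine ⟨_, ⟨i, fun j hj => ?_⟩, ⟨w i, x, rfl⟩, hl⟩
  have hper : ∀ k, k < q → w (i + 1 + k) = w (i + 1 + k + (q + 1)) := by
    intro k hk
    have := h (1 + k) (by omega)
    rwa [← add_assoc] at this
  rw [hl] at hj
  simp only [List.get_eq_getElem, List.getElem_append, List.length_append, List.length_singleton,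
    hxl, hxj, List.getElem_singleton]
  split_ifs with c1 c2 c3 c4
  · congr 1; omega
  · congr 1; omega
  · rw [h0]; congr 1; omega
  · rw [hper _ (by omega)]; congr 1; omega
  · rw [h0, h1]; congr 1; omega

/-- There are uncountably many infinite binary words avoiding 7/3-powers,
each containing arbitrarily large overlaps. -/
theorem uncountably_many_with_large_overlaps :
    ∃ W : Set (ℕ → Bool), ¬ W.Countable ∧
      ∀ w ∈ W, AvoidsPowSeq (7/3) w ∧
        ∀ N : ℕ, ∃ u : List Bool, IsFactorSeq u w ∧ IsOverlap u ∧ u.length > N := by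
  refine ⟨Set.range fun b => towerWord b 0, fun hc => ?_, ?_⟩
  · have hcount : Countable (ℕ → Bool) :=
      have := hc.to_subtype
      (Set.rangeFactorization_injective.mpr towerWord_injective).countable
    obtain ⟨f, hf⟩ := exists_surjective_nat (ℕ → Bool)
    obtain ⟨n, hn⟩ := hf fun k => !f k k
    simpa using congrFun hn n
  · rintro _ ⟨b, rfl⟩
    have hW := isTower_towerWord b
    refine ⟨avoidsPowSeq_of_not_periodOn fun p hp => hW.not_periodOn p hp 0, fun N => ?_⟩
    obtain ⟨n, hn, h⟩ : ∃ n, N ≤ n ∧ PeriodOn (towerWord b n) 0 6 13 := by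
      obtain ⟨h | h, -⟩ := blockCode_five b N
      · exact ⟨5 * N, by omega, hW.overlap (by simp [h]) (by simp [h]) (by simp [h])⟩
      · exact ⟨5 * N + 1, by omega, hW.overlap (by simp [h]) (by simp [h]) (by simp [h])⟩
    obtain ⟨i, hi⟩ := hW.exists_periodOn_zero h
    have hpow : n < 2 ^ n := Nat.lt_two_pow_self
    obtain ⟨u, hu, hu', hl⟩ := exists_isOverlap_of_periodOn (by omega) hi
    exact ⟨u, hu, hu', by omega⟩
end

section
/- For every integer i ≥ 1 there exists a finite overlap-free binary word of length 6·4^i that contains a square of order 4^i and contains no square of order greater than 4^i. Hence the bound that every overlap-free word of length l > 7 contains a square of order ≥ l/6 is best possible for arbitrarily large lengths. -/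
theorem mu_append (u v : List Bool) : mu (u ++ v) = mu u ++ mu v := by
  simp [mu]

theorem mu_cons (a : Bool) (w : List Bool) : mu (a :: w) = a :: (!a) :: mu w := by
  simp [mu]

theorem length_mu (w : List Bool) : (mu w).length = 2 * w.length := by
  induction w with
  | nil => rfl
  | cons a w ih => simp only [mu_cons, List.length_cons, ih]; omega

theorem iterate_mu_append (n : ℕ) (u v : List Bool) :
    mu^[n] (u ++ v) = mu^[n] u ++ mu^[n] v := by
  induction n generalizing u v with
  | zero => rfl
  | succ n ih => simp only [Function.iterate_succ_apply, mu_append, ih]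

theorem length_iterate_mu (n : ℕ) (w : List Bool) :
    (mu^[n] w).length = 2 ^ n * w.length := by
  induction n with
  | zero => simp
  | succ n ih => rw [Function.iterate_succ_apply', length_mu, ih]; ring

theorem getD_mu_even (w : List Bool) (k : ℕ) (h : k < w.length) :
    (mu w).getD (2 * k) false = w.getD k false := by
  induction w generalizing k with
  | nil => simp at h
  | cons a w ih =>
    rw [mu_cons]
    cases k with
    | zero => simp
    | succ k =>
      have := ih k (by simpa using h)
      simpa [Nat.mul_succ] using this

theorem getD_mu_odd (w : List Bool) (k : ℕ) (h : k < w.length) :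
    (mu w).getD (2 * k + 1) false = !w.getD k false := by
  induction w generalizing k with
  | nil => simp at h
  | cons a w ih =>
    rw [mu_cons]
    cases k with
    | zero => simp
    | succ k =>
      have := ih k (by simpa using h)
      simpa [Nat.mul_succ] using this

/-- From position `s` on, the first `m` letters of `w` agree with the letters `p` places
further right. -/
def HasRun (w : List Bool) (s p m : ℕ) : Prop :=
  s + p + m ≤ w.length ∧ ∀ j < m, w.getD (s + j) false = w.getD (s + j + p) false

theorem HasRun.mono {w : List Bool} {s p m m' : ℕ} (h : HasRun w s p m) (hm : m' ≤ m) :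
    HasRun w s p m' :=
  ⟨by have := h.1; omega, fun j hj => h.2 j (by omega)⟩

theorem hasRun_of_square_infix {x w : List Bool} (h : (x ++ x) <:+: w) :
    ∃ s, HasRun w s x.length x.length := by
  obtain ⟨l, r, rfl⟩ := h
  refine ⟨l.length, by simp; omega, fun j hj => ?_⟩
  simp only [List.getD_eq_getElem?_getD]
  grind

theorem hasRun_of_overlap_infix {u w : List Bool} (hu : IsOverlap u) (h : u <:+: w) :
    ∃ s p, 1 ≤ p ∧ HasRun w s p (p + 1) := by
  obtain ⟨a, x, rfl⟩ := hu
  obtain ⟨l, r, rfl⟩ := h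
  refine ⟨l.length, x.length + 1, by omega, by simp; omega, fun j hj => ?_⟩
  rw [show l ++ ([a] ++ x ++ [a] ++ x ++ [a]) ++ r =
    l ++ ((a :: x) ++ ((a :: x) ++ a :: r)) by simp, add_assoc]
  simp only [List.getD_eq_getElem?_getD, List.getElem?_append_right (Nat.le_add_right _ _),
    Nat.add_sub_cancel_left]
  rw [List.getElem?_append_right (l₁ := a :: x) (i := j + (x.length + 1)) (by simp),
    List.length_cons, Nat.add_sub_cancel]
  obtain h | rfl : j < x.length + 1 ∨ j = x.length + 1 := by omega
  · rw [List.getElem?_append_left (by simpa using h), List.getElem?_append_left (by simpa using h)]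
  · rw [List.getElem?_append_right (by simp),
      List.getElem?_append_right (i := x.length + 1) (by simp)]
    simp

/-- A run of even period `2 * q` in `mu w` comes from a run of period `q` in `w`. -/
theorem HasRun.of_mu_even {w : List Bool} {s q m : ℕ}
    (h : HasRun (mu w) s (2 * q) (2 * m - 1)) : HasRun w (s / 2) q m := by
  obtain ⟨hl, h⟩ := h
  rw [length_mu] at hl
  refine ⟨by omega, fun j hj => ?_⟩
  have hj' := h (2 * j) (by omega)
  obtain ⟨t, rfl | rfl⟩ := Nat.even_or_odd' s
  · rw [show 2 * t + 2 * j + 2 * q = 2 * (t + j + q) by ring,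
      show 2 * t + 2 * j = 2 * (t + j) by ring, getD_mu_even _ _ (by omega),
      getD_mu_even _ _ (by omega)] at hj'
    rwa [show 2 * t / 2 = t by omega]
  · rw [show 2 * t + 1 + 2 * j + 2 * q = 2 * (t + j + q) + 1 by ring,
      show 2 * t + 1 + 2 * j = 2 * (t + j) + 1 by ring, getD_mu_odd _ _ (by omega),
      getD_mu_odd _ _ (by omega)] at hj'
    rw [show (2 * t + 1) / 2 = t by omega]
    simpa using hj'

theorem getD_mu_succ_ne {w : List Bool} {k : ℕ} (hk : Even k) (h : k < (mu w).length) :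
    (mu w).getD k false ≠ (mu w).getD (k + 1) false := by
  obtain ⟨t, rfl⟩ := hk.exists_two_nsmul
  rw [length_mu] at h
  simp only [smul_eq_mul] at h ⊢
  rw [getD_mu_even _ _ (by omega), getD_mu_odd _ _ (by omega)]
  simp

/-- A square of odd order at least 5 in `mu w` begins with `ababa`, so that `w` contains a
cube of a letter. -/
theorem HasRun.le_three_of_mu_odd {w : List Bool} (hw : ∀ s, ¬ HasRun w s 1 2)
    {s p : ℕ} (hp : Odd p) (h : HasRun (mu w) s p p) : p ≤ 3 := by
  by_contra! hp3
  obtain ⟨c, rfl⟩ := hp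
  have hl := h.1
  have alt (j : ℕ) (hj : j < 2 * c) :
      (mu w).getD (s + j) false ≠ (mu w).getD (s + j + 1) false := by
    rcases Nat.even_or_odd (s + j) with he | ho
    · exact getD_mu_succ_ne he (by omega)
    · have := getD_mu_succ_ne (w := w) (k := s + j + (2 * c + 1))
        (ho.add_odd ⟨c, rfl⟩) (by omega)
      rw [h.2 j (by omega), add_assoc s j 1, h.2 (j + 1) (by omega)]
      rwa [show s + (j + 1) + (2 * c + 1) = s + j + (2 * c + 1) + 1 by ring]
  refine hw (s / 2) (HasRun.of_mu_even ⟨by omega, fun j hj => ?_⟩)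
  have h1 := alt j (by omega)
  have h2 := alt (j + 1) (by omega)
  rw [← add_assoc] at h2
  rw [show s + j + 2 * 1 = s + j + 1 + 1 by ring]
  revert h1 h2
  generalize (mu w).getD (s + j) false = a
  generalize (mu w).getD (s + j + 1) false = b
  generalize (mu w).getD (s + j + 1 + 1) false = d
  revert a b d
  decide

theorem bool_not_pairwise_ne {a b c : Bool} (hab : a ≠ b) (hac : a ≠ c) : ¬ b ≠ c := by
  revert a b c
  decide

theorem no_overlap_run_mu {w : List Bool} (hw : ∀ s p, 1 ≤ p → ¬ HasRun w s p (p + 1)) :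
    ∀ s p, 1 ≤ p → ¬ HasRun (mu w) s p (p + 1) := by
  intro s p hp h
  obtain ⟨q, rfl | rfl⟩ := Nat.even_or_odd' p
  · exact hw _ q (by omega) (HasRun.of_mu_even (h.mono (by omega)))
  · have hq := HasRun.le_three_of_mu_odd (fun s => hw s 1 le_rfl) ⟨q, rfl⟩ (h.mono (by omega))
    have hl := h.1
    have hne (j : ℕ) (hj : j ≤ 4 * q + 1) (he : Even (s + j)) :=
      getD_mu_succ_ne (w := w) he (by omega)
    have hr := h.2
    obtain rfl | rfl : q = 0 ∨ q = 1 := by omega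
    · have h0 := hr 0 (by omega)
      have h1 := hr 1 (by omega)
      rcases Nat.even_or_odd s with he | ho
      · exact hne 0 (by omega) he h0
      · exact hne 1 (by omega) (ho.add_odd odd_one) h1
    · have h0 := hr 0 (by omega)
      have h1 := hr 1 (by omega)
      have h2 := hr 2 (by omega)
      have h3 := hr 3 (by omega)
      simp only [add_assoc, Nat.reduceAdd, Nat.reduceMul] at h0 h1 h2 h3 hne
      rcases Nat.even_or_odd s with he | ho
      · have n0 := hne 0 (by omega) he
        have n2 := hne 2 (by omega) (he.add (by decide))
        have n4 := hne 4 (by omega) (he.add (by decide))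
        simp only [Nat.reduceAdd] at n0 n2 n4
        rw [← h0] at n2
        rw [← h1, ← h2] at n4
        exact bool_not_pairwise_ne n0 n2.symm n4
      · have n1 := hne 1 (by omega) (ho.add_odd (by decide))
        have n3 := hne 3 (by omega) (ho.add_odd (by decide))
        have n5 := hne 5 (by omega) (ho.add_odd (by decide))
        simp only [Nat.reduceAdd] at n1 n3 n5
        rw [← h0, ← h1] at n3
        rw [← h2, ← h3, ← h0] at n5
        exact bool_not_pairwise_ne n3 n5.symm n1

theorem square_run_mu_le {w : List Bool} {B : ℕ} (hB : 2 ≤ B) (hw : ∀ s, ¬ HasRun w s 1 2)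
    (hsq : ∀ s p, HasRun w s p p → p ≤ B) :
    ∀ s p, HasRun (mu w) s p p → p ≤ 2 * B := by
  intro s p h
  obtain ⟨q, rfl | rfl⟩ := Nat.even_or_odd' p
  · have := hsq _ q (HasRun.of_mu_even (h.mono (by omega)))
    omega
  · have := HasRun.le_three_of_mu_odd hw ⟨q, rfl⟩ h
    omega

/-- The word `001100101100`, whose largest squares have order 2. -/
def seedWord : List Bool :=
  [false, false, true, true, false, false, true, false, true, true, false, false]

theorem seedWord_no_overlap_run (s p : ℕ) (hp : 1 ≤ p) : ¬ HasRun seedWord s p (p + 1) := by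
  rintro ⟨hl, h⟩
  have hlen : seedWord.length = 12 := rfl
  have key : ∀ p < 6, 1 ≤ p → ∀ s < 12, s + p + (p + 1) ≤ 12 →
      ¬ ∀ j < p + 1, seedWord.getD (s + j) false = seedWord.getD (s + j + p) false := by
    decide
  exact key p (by omega) hp s (by omega) (by omega) h

theorem seedWord_square_run_le (s p : ℕ) (h : HasRun seedWord s p p) : p ≤ 2 := by
  obtain ⟨hl, h⟩ := h
  have hlen : seedWord.length = 12 := rfl
  by_contra! hp
  have key : ∀ p < 7, 2 < p → ∀ s < 12, s + p + p ≤ 12 →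
      ¬ ∀ j < p, seedWord.getD (s + j) false = seedWord.getD (s + j + p) false := by
    decide
  exact key p (by omega) hp s (by omega) (by omega) h

theorem iterate_mu_seedWord_no_overlap_run (n : ℕ) :
    ∀ s p, 1 ≤ p → ¬ HasRun (mu^[n] seedWord) s p (p + 1) := by
  induction n with
  | zero => exact seedWord_no_overlap_run
  | succ n ih => rw [Function.iterate_succ_apply']; exact no_overlap_run_mu ih

theorem iterate_mu_seedWord_square_run_le (n : ℕ) :
    ∀ s p, HasRun (mu^[n] seedWord) s p p → p ≤ 2 ^ n * 2 := by
  induction n with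
  | zero => exact seedWord_square_run_le
  | succ n ih =>
    rw [Function.iterate_succ_apply', pow_succ', mul_assoc]
    exact square_run_mu_le (by have := Nat.one_le_two_pow (n := n); omega)
      (fun s => iterate_mu_seedWord_no_overlap_run n s 1 le_rfl) ih

/-- For every i ≥ 1 there is an overlap-free binary word of length 6·4^i
whose largest square has order exactly 4^i; hence the l/6 bound is sharp for
arbitrarily large lengths. -/
theorem overlapFree_square_bound_sharp (i : ℕ) (hi : 1 ≤ i) :
    ∃ w : List Bool, OverlapFree w ∧ w.length = 6 * 4 ^ i ∧
      (∃ x : List Bool, x.length = 4 ^ i ∧ (x ++ x) <:+: w) ∧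
      ∀ x : List Bool, x ≠ [] → (x ++ x) <:+: w → x.length ≤ 4 ^ i := by
  obtain ⟨n, hn⟩ : ∃ n, 2 * i = n + 1 := ⟨2 * i - 1, by omega⟩
  have h4 : 4 ^ i = 2 ^ n * 2 := by
    rw [← pow_succ, ← hn, pow_mul]
    norm_num
  rw [h4]
  refine ⟨mu^[n] seedWord, ?_, ?_, ⟨mu^[n] [false, true], ?_, ?_⟩, ?_⟩
  · intro u hu ho
    obtain ⟨s, p, hp, h⟩ := hasRun_of_overlap_infix ho hu
    exact iterate_mu_seedWord_no_overlap_run _ s p hp h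
  · rw [length_iterate_mu, show seedWord.length = 12 from rfl]
    ring
  · simp [length_iterate_mu]
  · refine ⟨mu^[n] [false, false, true, true, false], mu^[n] [true, false, false], ?_⟩
    simp only [← iterate_mu_append]
    rfl
  · intro x _ hx
    obtain ⟨s, h⟩ := hasRun_of_square_infix hx
    exact iterate_mu_seedWord_square_run_le n s _ h
end

section
/- Every finite Restivo word of length l > 8 contains a square of order n with 7n ≥ l + 2; that is, it has a factor xx with x nonempty and |x| ≥ (l+2)/7. -/
/-- `w` contains a square of order at least `(|w| + 2) / 7`. -/
def HasLargeSquare (w : List Bool) : Prop :=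
  ∃ x : List Bool, x ≠ [] ∧ (x ++ x) <:+: w ∧ 7 * x.length ≥ w.length + 2

theorem mu_flatten (l : List (List Bool)) : mu l.flatten = (l.map mu).flatten := by
  induction l with
  | nil => rfl
  | cons a l ih => simp [mu_append, ih]

/-- Peeling off the first block of a Restivo product. -/
theorem restivoJoin_succ (x : ℕ → List Bool) (n : ℕ) :
    restivoJoin x (n + 1) = x 0 ++ mu (restivoJoin (fun i => x (i + 1)) n) := by
  simp [restivoJoin, List.range_succ_eq_map, mu_flatten, Function.comp_def,
    Function.iterate_succ_apply']

/-- Applying `μ` doubles both a word and the squares it contains. -/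
theorem HasLargeSquare.append_mu {v : List Bool} (hv : HasLargeSquare v) {x : List Bool}
    (hx : x.length ≤ 2) : HasLargeSquare (x ++ mu v) := by
  obtain ⟨y, hy, ⟨a, b, hab⟩, hlen⟩ := hv
  refine ⟨mu y, ?_, ⟨x ++ mu a, mu b, by simp [← hab, mu_append]⟩, ?_⟩
  · rw [← List.length_pos_iff] at hy ⊢
    rw [length_mu]
    omega
  · simp only [List.length_append, length_mu]
    omega

/-- The elements of `S`, as a list. -/
def blocks : List (List Bool) := [[], [false], [true], [false, false], [true, true]]

theorem mem_blocks {x : List Bool} (hx : x ∈ S) : x ∈ blocks := by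
  simpa [S, blocks] using hx

theorem length_le_two_of_mem_blocks {x : List Bool} (hx : x ∈ blocks) : x.length ≤ 2 := by
  revert x
  decide

/-- The words `x μ(v)` of length at most 8, for `v` in a given list and `x ∈ S`. -/
def extendShort (l : List (List Bool)) : List (List Bool) :=
  ((l.flatMap fun v => blocks.map fun x => x ++ mu v).filter fun w => w.length ≤ 8).dedup

/-- The Restivo words of length at most 8. -/
def shortRestivo : List (List Bool) := extendShort^[4] [[]]

theorem append_mu_mem_shortRestivo : ∀ v ∈ shortRestivo, ∀ x ∈ blocks,
    (x ++ mu v).length ≤ 8 → x ++ mu v ∈ shortRestivo := by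
  decide +kernel

/-- A square located by its starting position and its order. -/
theorem hasLargeSquare_of_take_drop {w : List Bool} {n i : ℕ}
    (hi : i + 2 * n ≤ w.length) (hw : 7 * n ≥ w.length + 2)
    (h : (w.drop i).take n = (w.drop (i + n)).take n) : HasLargeSquare w := by
  have hlen : ((w.drop i).take n).length = n := by
    rw [List.length_take, List.length_drop]
    omega
  refine ⟨(w.drop i).take n, ?_, ⟨w.take i, w.drop (i + n + n), ?_⟩, ?_⟩
  · rw [← List.length_pos_iff, hlen]
    omega
  · nth_rewrite 2 [h]
    rw [← List.drop_drop (i := n) (j := i + n), List.append_assoc, List.append_assoc,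
      List.take_append_drop, ← List.drop_drop, List.take_append_drop, List.take_append_drop]
  · rwa [hlen]

theorem exists_square_append_mu : ∀ v ∈ shortRestivo, ∀ x ∈ blocks,
    8 < (x ++ mu v).length → ∃ n < 10, ∃ i < 19,
      i + 2 * n ≤ (x ++ mu v).length ∧ 7 * n ≥ (x ++ mu v).length + 2 ∧
      ((x ++ mu v).drop i).take n = ((x ++ mu v).drop (i + n)).take n := by
  decide +kernel

theorem restivoJoin_mem_shortRestivo_or_hasLargeSquare (n : ℕ) (x : ℕ → List Bool)
    (hx : ∀ i < n, x i ∈ S) :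
    restivoJoin x n ∈ shortRestivo ∨ HasLargeSquare (restivoJoin x n) := by
  induction n generalizing x with
  | zero =>
    left
    change [] ∈ shortRestivo
    decide +kernel
  | succ n ih =>
    rw [restivoJoin_succ]
    have h0 : x 0 ∈ blocks := mem_blocks (hx 0 n.succ_pos)
    rcases ih (fun i => x (i + 1)) fun i hi => hx (i + 1) (by omega) with h | h
    · by_cases hl : (x 0 ++ mu (restivoJoin (fun i => x (i + 1)) n)).length ≤ 8
      · exact Or.inl (append_mu_mem_shortRestivo _ h _ h0 hl)
      · obtain ⟨k, -, i, -, hi, hw, heq⟩ :=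
          exists_square_append_mu _ h _ h0 (not_le.mp hl)
        exact Or.inr (hasLargeSquare_of_take_drop hi hw heq)
    · exact Or.inr (h.append_mu (length_le_two_of_mem_blocks h0))

theorem length_le_of_mem_shortRestivo : ∀ w ∈ shortRestivo, w.length ≤ 8 := by
  decide +kernel

/-- Every finite Restivo word of length l > 8 contains a square of order
≥ (l+2)/7. -/
theorem restivo_large_square (w : List Bool) (h : IsRestivo w)
    (hl : w.length > 8) :
    ∃ x : List Bool, x ≠ [] ∧ (x ++ x) <:+: w ∧ 7 * x.length ≥ w.length + 2 := by
  obtain ⟨t, x, hx, rfl⟩ := h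
  rcases restivoJoin_mem_shortRestivo_or_hasLargeSquare (t + 1) x
    fun i hi => hx i (Nat.lt_succ_iff.mp hi) with h | h
  · exact absurd (length_le_of_mem_shortRestivo _ h) (not_le.mpr hl)
  · exact h
end

section
/- Every infinite overlap-free binary word contains squares of arbitrarily large order; that is, for every integer N there is a factor xx of the word with x nonempty and |x| > N. -/
/-- Index form of overlap-freeness: no factor of length `2 * p + 1` has period `p`. -/
theorem OverlapFreeSeq.exists_ne {w : ℕ → Bool} (h : OverlapFreeSeq w) (i p : ℕ) (hp : 1 ≤ p) :
    ∃ j ≤ p, w (i + j) ≠ w (i + j + p) := by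
  by_contra! hc
  obtain ⟨q, rfl⟩ : ∃ q, p = q + 1 := ⟨p - 1, by omega⟩
  let x : List Bool := List.ofFn fun j : Fin q => w (i + 1 + j)
  have hx : x.length = q := List.length_ofFn
  refine h ([w i] ++ x ++ [w i] ++ x ++ [w i]) ⟨i, fun j hj => ?_⟩ ⟨w i, x, rfl⟩
  have h0 : w i = w (i + (q + 1)) := hc 0 (by omega)
  have h1 : w (i + (q + 1)) = w (i + (q + 1) + (q + 1)) := hc (q + 1) le_rfl
  simp only [List.length_append, List.length_singleton, hx] at hj
  simp only [List.get_eq_getElem, List.getElem_append, List.length_append, List.length_singleton,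
    List.getElem_singleton, hx]
  split_ifs with h2 h3 h4 h5
  · congr 1; omega
  · simp only [x, List.getElem_ofFn]
    congr 1; omega
  · rw [h0]; congr 1; omega
  · simp only [x, List.getElem_ofFn]
    rw [show i + 1 + (j - (1 + q + 1)) = i + (j - (q + 1)) by omega, hc _ (by omega)]
    congr 1; omega
  · rw [h0, h1]; congr 1; omega

/-- Conversely, a word without factors of length `2 * p + 1` and period `p` is overlap-free. -/
theorem overlapFreeSeq_of_exists_ne {w : ℕ → Bool}
    (h : ∀ i p : ℕ, 1 ≤ p → ∃ j ≤ p, w (i + j) ≠ w (i + j + p)) : OverlapFreeSeq w := by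
  rintro _ ⟨i, hi⟩ ⟨a, x, rfl⟩
  obtain ⟨j, hj, hne⟩ := h i (x.length + 1) (by omega)
  apply hne
  rw [add_assoc, ← hi j (by simp; omega), ← hi (j + (x.length + 1)) (by simp; omega)]
  have hx : [a] ++ x ++ [a] ++ x ++ [a] = (a :: x) ++ ((a :: x) ++ [a]) := by simp
  simp only [List.get_eq_getElem, hx]
  rw [List.getElem_append_right (i := j + (x.length + 1)) (by simp)]
  simp only [List.length_cons, Nat.add_sub_cancel]
  rcases hj.lt_or_eq with hj | rfl
  · rw [List.getElem_append_left (by simpa using hj), List.getElem_append_left (by simpa using hj)]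
  · simp

/-- Among five consecutive letters of an overlap-free word, two adjacent ones are equal. -/
theorem OverlapFreeSeq.exists_eq_succ {w : ℕ → Bool} (h : OverlapFreeSeq w) (i : ℕ) :
    ∃ j < 4, w (i + j) = w (i + j + 1) := by
  by_contra! hc
  obtain ⟨j, hj, hne⟩ := h.exists_ne i 2 (by omega)
  have h1 := hc j (by omega)
  have h2 := hc (j + 1) (by omega)
  exact hne ((Bool.eq_not.2 h1).trans (Bool.eq_not.2 h2.symm).symm)

/-- After a repeated letter away from the beginning of an overlap-free word, the next repeated
letter occurs at distance 2 or 4. -/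
theorem OverlapFreeSeq.next_eq_succ {w : ℕ → Bool} (h : OverlapFreeSeq w) {i : ℕ}
    (hi : w (i + 1) = w (i + 2)) :
    w (i + 2) ≠ w (i + 3) ∧ w (i + 4) ≠ w (i + 5) ∧
      (w (i + 3) = w (i + 4) ∨ w (i + 5) = w (i + 6)) := by
  have cube (k : ℕ) : ¬ (w k = w (k + 1) ∧ w (k + 1) = w (k + 2)) := by
    rintro ⟨h1, h2⟩
    obtain ⟨j, hj, hne⟩ := h.exists_ne k 1 le_rfl
    interval_cases j <;> contradiction
  have alt (k : ℕ) : ¬ (w k = w (k + 2) ∧ w (k + 1) = w (k + 3) ∧ w (k + 2) = w (k + 4)) := by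
    rintro ⟨h1, h2, h3⟩
    obtain ⟨j, hj, hne⟩ := h.exists_ne k 2 (by omega)
    interval_cases j <;> contradiction
  have three (k : ℕ) : ¬ (w k = w (k + 3) ∧ w (k + 1) = w (k + 4) ∧ w (k + 2) = w (k + 5) ∧
      w (k + 3) = w (k + 6)) := by
    rintro ⟨h1, h2, h3, h4⟩
    obtain ⟨j, hj, hne⟩ := h.exists_ne k 3 (by omega)
    interval_cases j <;> contradiction
  have c0 := cube i
  have c1 := cube (i + 1)
  have c3 := cube (i + 3)
  have c4 := cube (i + 4)
  have a2 := alt (i + 2)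
  have t0 := three i
  simp only [add_assoc, Nat.reduceAdd] at c0 c1 c3 c4 a2 t0
  revert hi c0 c1 c3 c4 a2 t0
  generalize w i = x0, w (i + 1) = x1, w (i + 2) = x2, w (i + 3) = x3, w (i + 4) = x4,
    w (i + 5) = x5, w (i + 6) = x6
  cases x0 <;> cases x1 <;> cases x2 <;> cases x3 <;> cases x4 <;> cases x5 <;> cases x6 <;> simp

theorem OverlapFreeSeq.ne_of_eq_succ {w : ℕ → Bool} (h : OverlapFreeSeq w) (n : ℕ) :
    ∀ i, w (i + 1) = w (i + 2) → w (i + 2 + 2 * n) ≠ w (i + 2 + 2 * n + 1) := by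
  induction n using Nat.strong_induction_on with
  | _ n ih =>
    intro i hi
    obtain ⟨h1, h2, h3⟩ := h.next_eq_succ hi
    match n, ih with
    | 0, _ => exact h1
    | 1, _ => exact h2
    | n + 2, ih =>
      rcases h3 with h3 | h3
      · convert ih (n + 1) (by omega) (i + 2) h3 using 2 <;> ring_nf
      · convert ih n (by omega) (i + 4) h3 using 2 <;> ring_nf

/-- Some suffix of an overlap-free word is the Thue–Morse image of its even-indexed letters. -/
theorem OverlapFreeSeq.exists_forall_ne {w : ℕ → Bool} (h : OverlapFreeSeq w) :
    ∃ k, ∀ n, w (k + 2 * n) ≠ w (k + 2 * n + 1) := by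
  obtain ⟨j, -, hj⟩ := h.exists_eq_succ 1
  refine ⟨j + 2, fun n => h.ne_of_eq_succ n j ?_⟩
  convert hj using 2 <;> omega

/-- If `w` is, from position `k` on, the Thue–Morse image of `n ↦ w (k + 2 * n)`, then a
repetition of period `p` in the preimage yields one of period `2 * p` in `w`. -/
theorem eq_add_two_mul_of_preimage {w : ℕ → Bool} {k : ℕ}
    (hk : ∀ n, w (k + 2 * n) ≠ w (k + 2 * n + 1)) {i p m : ℕ}
    (hv : ∀ j < m, w (k + 2 * (i + j)) = w (k + 2 * (i + j + p))) :
    ∀ j < 2 * m, w (k + 2 * i + j) = w (k + 2 * i + j + 2 * p) := by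
  intro j hj
  have h0 := hv (j / 2) (by omega)
  have h1 := hk (i + j / 2)
  have h2 := hk (i + j / 2 + p)
  rcases Nat.mod_two_eq_zero_or_one j with hm | hm
  · convert h0 using 2 <;> omega
  · rw [show k + 2 * i + j = k + 2 * (i + j / 2) + 1 by omega,
      show k + 2 * (i + j / 2) + 1 + 2 * p = k + 2 * (i + j / 2 + p) + 1 by omega]
    rw [Bool.eq_not.2 h1.symm, Bool.eq_not.2 h2.symm, h0]

theorem OverlapFreeSeq.preimage {w : ℕ → Bool} (h : OverlapFreeSeq w) {k : ℕ}
    (hk : ∀ n, w (k + 2 * n) ≠ w (k + 2 * n + 1)) :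
    OverlapFreeSeq fun n => w (k + 2 * n) := by
  refine overlapFreeSeq_of_exists_ne fun i p hp => ?_
  by_contra! hc
  obtain ⟨j, hj, hne⟩ := h.exists_ne (k + 2 * i) (2 * p) (by omega)
  exact hne (eq_add_two_mul_of_preimage (m := p + 1) hk (fun j hj => hc j (by omega)) j (by omega))

theorem OverlapFreeSeq.exists_square {w : ℕ → Bool} (h : OverlapFreeSeq w) (n : ℕ) :
    ∃ i, ∀ j < 2 ^ n, w (i + j) = w (i + j + 2 ^ n) := by
  induction n generalizing w with
  | zero =>
    obtain ⟨j, -, hj⟩ := h.exists_eq_succ 0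
    refine ⟨0 + j, fun l hl => ?_⟩
    obtain rfl : l = 0 := by simpa using hl
    exact hj
  | succ n ih =>
    obtain ⟨k, hk⟩ := h.exists_forall_ne
    obtain ⟨i, hi⟩ := ih (h.preimage hk)
    refine ⟨k + 2 * i, ?_⟩
    rw [pow_succ']
    exact eq_add_two_mul_of_preimage hk hi

/-- Every infinite overlap-free binary word contains squares of arbitrarily
large order. -/
theorem overlapFreeSeq_large_squares (w : ℕ → Bool) (h : OverlapFreeSeq w)
    (N : ℕ) :
    ∃ x : List Bool, x ≠ [] ∧ IsFactorSeq (x ++ x) w ∧ x.length > N := by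
  obtain ⟨i, hi⟩ := h.exists_square N
  let x : List Bool := List.ofFn fun j : Fin (2 ^ N) => w (i + j)
  have hx : x.length = 2 ^ N := List.length_ofFn
  refine ⟨x, List.ne_nil_of_length_pos (by rw [hx]; positivity), ⟨i, fun j hj => ?_⟩,
    by rw [hx]; exact Nat.lt_two_pow_self⟩
  simp only [List.length_append, hx] at hj
  simp only [List.get_eq_getElem, List.getElem_append, hx]
  split_ifs with h1
  · simp only [x, List.getElem_ofFn]
  · simp only [x, List.getElem_ofFn]
    rw [hi _ (by omega)]
    congr 1; omega
end
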